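/- Let n ≥ 3. For the flower graph F_n, the minimum second chromatic Zagreb index satisfies M₂^{φ−}(F_n) = 13n if n is even, and M₂^{φ−}(F_n) = 13n + 16 if n is odd. -/

import Mathlib

open Finset

/-- Vertex type: `none` is the center `u`; `some (Sum.inl i)` is `uᵢ`;
`some (Sum.inr i)` is `vᵢ`. -/
abbrev GV (n : ℕ) : Type := Option (Fin n ⊕ Fin n)

/-- `j = i + 1 (mod n)`: `j` is the cyclic successor of `i` in `Fin n`. -/
def NextIdx {n : ℕ} (i j : Fin n) : Prop := (j : ℕ) = ((i : ℕ) + 1) % n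

/-- The flower graph `F_n`: edges `uᵢu_{i+1}` (indices mod `n`), `u uᵢ`,
`uᵢvᵢ` and `u vᵢ` for all `i`. -/
def flowerGraph (n : ℕ) : SimpleGraph (GV n) :=
  SimpleGraph.fromRel (fun a b =>
    (∃ i j : Fin n, NextIdx i j ∧ a = some (Sum.inl i) ∧ b = some (Sum.inl j)) ∨
    (∃ i : Fin n, a = none ∧ b = some (Sum.inl i)) ∨
    (∃ i : Fin n, a = some (Sum.inl i) ∧ b = some (Sum.inr i)) ∨
    (∃ i : Fin n, a = none ∧ b = some (Sum.inr i)))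

/-- `ζ` is a proper vertex coloring of `G` using the colors `{1, …, k}`:
every vertex gets a color in `{1, …, k}` and adjacent vertices get
different colors. -/
def IsProperColoring {V : Type} (G : SimpleGraph V) (k : ℕ) (ζ : V → ℕ) : Prop :=
  (∀ v, 1 ≤ ζ v ∧ ζ v ≤ k) ∧ ∀ ⦃a b⦄, G.Adj a b → ζ a ≠ ζ b

/-- The chromatic number of `G`, as a natural number. -/
noncomputable def chi {V : Type} (G : SimpleGraph V) : ℕ := G.chromaticNumber.toNat

/-- The second chromatic Zagreb index: `∑_{uv ∈ E(G)} ζ(u)·ζ(v)`. -/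
noncomputable def M2 {V : Type} [Fintype V] [DecidableEq V] (G : SimpleGraph V)
    (ζ : V → ℕ) : ℚ :=
  letI : DecidableRel G.Adj := fun a b => Classical.dec _
  ∑ e ∈ G.edgeFinset, Sym2.lift ⟨fun a b => (ζ a : ℚ) * ζ b, fun _ _ => mul_comm _ _⟩ e

/-- The cyclic successor on `Fin n`. -/
def cyclicSucc {n : ℕ} (i : Fin n) : Fin n := ⟨((i : ℕ) + 1) % n, Nat.mod_lt _ i.pos⟩

theorem nextIdx_iff {n : ℕ} {i j : Fin n} : NextIdx i j ↔ j = cyclicSucc i := by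
  simp [NextIdx, cyclicSucc, Fin.ext_iff]

theorem cyclicSucc_ne {n : ℕ} (hn : 2 ≤ n) (i : Fin n) : cyclicSucc i ≠ i := by
  intro h
  have h' : ((i : ℕ) + 1) % n = i := congrArg Fin.val h
  have := i.isLt
  rcases Nat.lt_or_ge (i + 1) n with h1 | h1
  · rw [Nat.mod_eq_of_lt h1] at h'
    omega
  · rw [show (i : ℕ) + 1 = n by omega, Nat.mod_self] at h'
    omega

theorem cyclicSucc_cyclicSucc_ne {n : ℕ} (hn : 3 ≤ n) (i : Fin n) :
    cyclicSucc (cyclicSucc i) ≠ i := by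
  intro h
  have h' : (((i : ℕ) + 1) % n + 1) % n = i := congrArg Fin.val h
  have := i.isLt
  rw [Nat.mod_add_mod] at h'
  rcases Nat.lt_or_ge (i + 1 + 1) n with h1 | h1
  · rw [Nat.mod_eq_of_lt h1] at h'
    omega
  · rw [Nat.mod_eq_sub_mod h1, Nat.mod_eq_of_lt (by omega)] at h'
    omega

/-- A predicate that alternates around a cycle forces the cycle to have even length. -/
theorem even_of_alternating {n : ℕ} (hn : 0 < n) (P : Fin n → Prop)
    (h : ∀ i, P (cyclicSucc i) ↔ ¬ P i) : Even n := by
  have key : ∀ k : ℕ, P ⟨k % n, Nat.mod_lt _ hn⟩ ↔ (Even k ↔ P ⟨0, hn⟩) := by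
    intro k
    induction k with
    | zero => simp
    | succ k ih =>
      have h1 := h ⟨k % n, Nat.mod_lt _ hn⟩
      have h2 : cyclicSucc ⟨k % n, Nat.mod_lt _ hn⟩ = (⟨(k + 1) % n, Nat.mod_lt _ hn⟩ : Fin n) := by
        simp [cyclicSucc]
      rw [h2] at h1
      rw [h1, ih, Nat.even_add_one]
      tauto
  have := key n
  simp only [Nat.mod_self] at this
  tauto

/-- In a proper coloring of an odd cycle, every color is missed by some edge. -/
theorem exists_edge_avoiding {n : ℕ} (hn : Odd n) (a : Fin n → ℕ)
    (ha : ∀ i, a i ≠ a (cyclicSucc i)) (r : ℕ) : ∃ i, a i ≠ r ∧ a (cyclicSucc i) ≠ r := by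
  by_contra! h
  refine Nat.not_even_iff_odd.mpr hn (even_of_alternating hn.pos (fun i => a i = r) fun i => ?_)
  have := ha i
  have := h i
  grind

theorem flowerGraph_adj_cycle {n : ℕ} (hn : 3 ≤ n) (i : Fin n) :
    (flowerGraph n).Adj (some (Sum.inl i)) (some (Sum.inl (cyclicSucc i))) := by
  have := cyclicSucc_ne (by omega) i
  simp [flowerGraph, nextIdx_iff, this.symm]

theorem flowerGraph_adj_center_inl {n : ℕ} (i : Fin n) :
    (flowerGraph n).Adj none (some (Sum.inl i)) := by
  simp [flowerGraph]

theorem flowerGraph_adj_center_inr {n : ℕ} (i : Fin n) :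
    (flowerGraph n).Adj none (some (Sum.inr i)) := by
  simp [flowerGraph]

theorem flowerGraph_adj_pendant {n : ℕ} (i : Fin n) :
    (flowerGraph n).Adj (some (Sum.inl i)) (some (Sum.inr i)) := by
  simp [flowerGraph]

/-- The edges of the flower graph, listed by type: cycle, spoke, pendant, petal. -/
def flowerEdge {n : ℕ} : Fin n ⊕ Fin n ⊕ Fin n ⊕ Fin n → Sym2 (GV n)
  | .inl i => s(some (Sum.inl i), some (Sum.inl (cyclicSucc i)))
  | .inr (.inl i) => s(none, some (Sum.inl i))
  | .inr (.inr (.inl i)) => s(some (Sum.inl i), some (Sum.inr i))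
  | .inr (.inr (.inr i)) => s(none, some (Sum.inr i))

theorem flowerEdge_injective {n : ℕ} (hn : 3 ≤ n) :
    Function.Injective (flowerEdge (n := n)) := by
  rintro (i | i | i | i) (j | j | j | j) h <;>
    simp [flowerEdge] at h ⊢
  all_goals try exact h
  · rcases h with h | h
    · exact h.1
    · exact absurd (by rw [h.2, ← h.1]) (cyclicSucc_cyclicSucc_ne hn i)

theorem mem_edgeSet_flowerGraph {n : ℕ} (hn : 3 ≤ n) (e : Sym2 (GV n)) :
    e ∈ (flowerGraph n).edgeSet ↔ ∃ x, flowerEdge x = e := by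
  constructor
  · induction e with
    | _ x y =>
      intro h
      rw [SimpleGraph.mem_edgeSet] at h
      obtain ⟨-, h | h⟩ := h
      · rcases h with ⟨i, j, hij, rfl, rfl⟩ | ⟨i, rfl, rfl⟩ | ⟨i, rfl, rfl⟩ | ⟨i, rfl, rfl⟩
        · exact ⟨.inl i, by rw [nextIdx_iff.mp hij]; rfl⟩
        · exact ⟨.inr (.inl i), rfl⟩
        · exact ⟨.inr (.inr (.inl i)), rfl⟩
        · exact ⟨.inr (.inr (.inr i)), rfl⟩
      · rw [Sym2.eq_swap]
        rcases h with ⟨i, j, hij, rfl, rfl⟩ | ⟨i, rfl, rfl⟩ | ⟨i, rfl, rfl⟩ | ⟨i, rfl, rfl⟩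
        · exact ⟨.inl i, by rw [nextIdx_iff.mp hij]; rfl⟩
        · exact ⟨.inr (.inl i), rfl⟩
        · exact ⟨.inr (.inr (.inl i)), rfl⟩
        · exact ⟨.inr (.inr (.inr i)), rfl⟩
  · rintro ⟨i | i | i | i, rfl⟩
    · exact flowerGraph_adj_cycle hn i
    · exact flowerGraph_adj_center_inl i
    · exact flowerGraph_adj_pendant i
    · exact flowerGraph_adj_center_inr i

/-- The second chromatic Zagreb index of the flower graph as a sum over the petals. -/
theorem M2_flowerGraph {n : ℕ} (hn : 3 ≤ n) (ζ : GV n → ℕ) :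
    M2 (flowerGraph n) ζ = ((∑ i : Fin n,
      ((ζ none * (ζ (some (Sum.inl i)) + ζ (some (Sum.inr i))) +
        ζ (some (Sum.inl i)) * ζ (some (Sum.inr i))) +
        ζ (some (Sum.inl i)) * ζ (some (Sum.inl (cyclicSucc i)))) : ℕ) : ℚ) := by
  classical
  unfold M2
  rw [← Finset.sum_nbij (s := Finset.univ) (flowerEdge (n := n))
    (f := fun x => Sym2.lift ⟨fun a b => (ζ a : ℚ) * ζ b, fun _ _ => mul_comm _ _⟩ (flowerEdge x))
    (fun x _ => by
      rw [SimpleGraph.mem_edgeFinset, mem_edgeSet_flowerGraph hn]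
      exact ⟨x, rfl⟩)
    (flowerEdge_injective hn).injOn
    (fun e he => by
      rw [SimpleGraph.coe_edgeFinset, mem_edgeSet_flowerGraph hn] at he
      simpa using he)
    (fun _ _ => rfl)]
  simp only [Fintype.sum_sum_type, flowerEdge, Sym2.lift_mk]
  push_cast
  simp only [mul_add, Finset.sum_add_distrib]
  ring

/-- The coloring of the flower graph with center color `c`, cycle colors `a` and petal
colors `b`. -/
def flowerColoring {n : ℕ} (c : ℕ) (a b : Fin n → ℕ) : GV n → ℕ
  | none => c
  | some (Sum.inl i) => a i
  | some (Sum.inr i) => b i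

theorem isProperColoring_flowerGraph_iff {n : ℕ} (hn : 3 ≤ n) (k : ℕ) (ζ : GV n → ℕ) :
    IsProperColoring (flowerGraph n) k ζ ↔ (1 ≤ ζ none ∧ ζ none ≤ k) ∧ ∀ i : Fin n,
      (1 ≤ ζ (some (Sum.inl i)) ∧ ζ (some (Sum.inl i)) ≤ k) ∧
      (1 ≤ ζ (some (Sum.inr i)) ∧ ζ (some (Sum.inr i)) ≤ k) ∧
      ζ none ≠ ζ (some (Sum.inl i)) ∧ ζ none ≠ ζ (some (Sum.inr i)) ∧
      ζ (some (Sum.inl i)) ≠ ζ (some (Sum.inr i)) ∧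
      ζ (some (Sum.inl i)) ≠ ζ (some (Sum.inl (cyclicSucc i))) := by
  constructor
  · rintro ⟨h1, h2⟩
    exact ⟨h1 _, fun i => ⟨h1 _, h1 _, h2 (flowerGraph_adj_center_inl i),
      h2 (flowerGraph_adj_center_inr i), h2 (flowerGraph_adj_pendant i),
      h2 (flowerGraph_adj_cycle hn i)⟩⟩
  · rintro ⟨h1, h2⟩
    refine ⟨?_, ?_⟩
    · rintro (_ | i | i)
      exacts [h1, (h2 i).1, (h2 i).2.1]
    · intro x y hxy
      obtain ⟨e, he⟩ := (mem_edgeSet_flowerGraph hn s(x, y)).mp hxy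
      rcases e with i | i | i | i <;> obtain ⟨-, -, h3, h4, h5, h6⟩ := h2 i <;>
        rcases Sym2.eq_iff.mp he with ⟨rfl, rfl⟩ | ⟨rfl, rfl⟩
      exacts [h6, h6.symm, h3, h3.symm, h5, h5.symm, h4, h4.symm]

theorem colorable_iff_exists_isProperColoring {V : Type} (G : SimpleGraph V) (k : ℕ) :
    G.Colorable k ↔ ∃ ζ, IsProperColoring G k ζ := by
  constructor
  · rintro ⟨C⟩
    refine ⟨fun v => C v + 1, fun v => ⟨Nat.le_add_left 1 _, (C v).isLt⟩, fun a b hab h => C.valid hab ?_⟩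
    exact Fin.ext (by simpa using h)
  · rintro ⟨ζ, h1, h2⟩
    refine ⟨SimpleGraph.Coloring.mk (fun v => ⟨ζ v - 1, by
      have := h1 v
      omega⟩) ?_⟩
    intro a b hab h
    have h3 : ζ a - 1 = ζ b - 1 := Fin.ext_iff.mp h
    have := h1 a
    have := h1 b
    exact h2 hab (by omega)

theorem chi_eq_succ {V : Type} (G : SimpleGraph V) (k : ℕ) (ζ : V → ℕ)
    (h : IsProperColoring G (k + 1) ζ) (h' : ∀ ξ, ¬ IsProperColoring G k ξ) : chi G = k + 1 := by
  have h1 : G.Colorable (k + 1) := (colorable_iff_exists_isProperColoring G _).mpr ⟨ζ, h⟩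
  have h2 : ¬ G.Colorable k := fun hc =>
    let ⟨ξ, hξ⟩ := (colorable_iff_exists_isProperColoring G _).mp hc
    h' ξ hξ
  have h3 : G.chromaticNumber = ((k + 1 : ℕ) : ℕ∞) := by
    refine le_antisymm h1.chromaticNumber_le ?_
    by_contra hlt
    rw [not_le] at hlt
    exact h2 (SimpleGraph.chromaticNumber_le_iff_colorable.mp
      (Order.le_of_lt_add_one (by exact_mod_cast hlt)))
  rw [chi, h3, ENat.toNat_natCast]

theorem not_isProperColoring_two {n : ℕ} (hn : 3 ≤ n) (ξ : GV n → ℕ) :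
    ¬ IsProperColoring (flowerGraph n) 2 ξ := by
  rw [isProperColoring_flowerGraph_iff hn]
  rintro ⟨h1, h2⟩
  have := h2 ⟨0, by omega⟩
  omega

theorem not_isProperColoring_three {n : ℕ} (hn : 3 ≤ n) (hodd : Odd n) (ξ : GV n → ℕ) :
    ¬ IsProperColoring (flowerGraph n) 3 ξ := by
  rw [isProperColoring_flowerGraph_iff hn]
  rintro ⟨h1, h2⟩
  obtain ⟨i, hi, hi'⟩ := exists_edge_avoiding hodd (fun i => ξ (some (Sum.inl i)))
    (fun i => (h2 i).2.2.2.2.2) (ξ (some (Sum.inl ⟨0, by omega⟩)))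
  have := h2 ⟨0, by omega⟩
  have := h2 i
  have := h2 (cyclicSucc i)
  omega

/-- The optimal coloring of the flower graph for even `n`. -/
def evenFlowerColoring (n : ℕ) : GV n → ℕ :=
  flowerColoring 3 (fun i => (i : ℕ) % 2 + 1) (fun i => 2 - (i : ℕ) % 2)

/-- The optimal coloring of the flower graph for odd `n`. -/
def oddFlowerColoring (n : ℕ) : GV n → ℕ :=
  flowerColoring 3 (fun i => if (i : ℕ) + 1 = n then 4 else (i : ℕ) % 2 + 1)
    (fun i => if (i : ℕ) + 1 = n then 1 else 2 - (i : ℕ) % 2)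

theorem val_cyclicSucc {n : ℕ} (i : Fin n) :
    ((cyclicSucc i : Fin n) : ℕ) = if (i : ℕ) + 1 = n then 0 else (i : ℕ) + 1 := by
  have := i.isLt
  split_ifs with h
  · simp [cyclicSucc, h]
  · exact Nat.mod_eq_of_lt (by omega)

theorem isProperColoring_even {n : ℕ} (hn : 3 ≤ n) (he : Even n) :
    IsProperColoring (flowerGraph n) 3 (evenFlowerColoring n) := by
  rw [isProperColoring_flowerGraph_iff hn]
  refine ⟨by simp [evenFlowerColoring, flowerColoring], fun i => ?_⟩
  have := i.isLt
  obtain ⟨m, rfl⟩ := he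
  simp only [evenFlowerColoring, flowerColoring, val_cyclicSucc]
  split_ifs <;> omega

theorem isProperColoring_odd {n : ℕ} (hn : 3 ≤ n) (ho : Odd n) :
    IsProperColoring (flowerGraph n) 4 (oddFlowerColoring n) := by
  rw [isProperColoring_flowerGraph_iff hn]
  refine ⟨by simp [oddFlowerColoring, flowerColoring], fun i => ?_⟩
  have := i.isLt
  obtain ⟨m, rfl⟩ := ho
  simp only [oddFlowerColoring, flowerColoring, val_cyclicSucc]
  split_ifs <;> omega

theorem M2_evenFlowerColoring {n : ℕ} (hn : 3 ≤ n) (he : Even n) :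
    M2 (flowerGraph n) (evenFlowerColoring n) = 13 * (n : ℚ) := by
  rw [M2_flowerGraph hn, Finset.sum_congr rfl (g := fun _ => 13)]
  · simp [mul_comm]
  · intro i _
    have := i.isLt
    obtain ⟨m, rfl⟩ := he
    simp only [evenFlowerColoring, flowerColoring, val_cyclicSucc]
    rcases Nat.mod_two_eq_zero_or_one i with h | h
    · rw [if_neg (by omega), h, show ((i : ℕ) + 1) % 2 = 1 by omega]
    · split_ifs
      · simp [h]
      · rw [h, show ((i : ℕ) + 1) % 2 = 0 by omega]

theorem M2_oddFlowerColoring {n : ℕ} (hn : 3 ≤ n) (ho : Odd n) :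
    M2 (flowerGraph n) (oddFlowerColoring n) = 13 * (n : ℚ) + 16 := by
  obtain ⟨m, rfl⟩ := ho
  rw [M2_flowerGraph hn, Finset.sum_congr rfl (g := fun i : Fin (2 * m + 1) =>
    13 + (if i = ⟨2 * m, by omega⟩ then 10 else 0) +
      (if i = ⟨2 * m - 1, by omega⟩ then 6 else 0))]
  · simp only [Finset.sum_add_distrib, Finset.sum_ite_eq', Finset.mem_univ, if_true,
      Finset.sum_const, Finset.card_univ, Fintype.card_fin, smul_eq_mul]
    push_cast
    ring
  · intro i _
    have := i.isLt
    simp only [oddFlowerColoring, flowerColoring, val_cyclicSucc, Fin.ext_iff]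
    rcases Nat.mod_two_eq_zero_or_one i with h | h
    · rw [h]
      split_ifs <;> omega
    · rw [h]
      split_ifs <;> omega

theorem le_sum_of_even {n : ℕ} {c : ℕ} {a b : Fin n → ℕ} (s : Fin n → Fin n)
    (hc : 1 ≤ c ∧ c ≤ 3)
    (h : ∀ i, (1 ≤ a i ∧ a i ≤ 3) ∧ (1 ≤ b i ∧ b i ≤ 3) ∧ c ≠ a i ∧ c ≠ b i ∧ a i ≠ b i ∧
      a i ≠ a (s i)) :
    13 * n ≤ ∑ i, ((c * (a i + b i) + a i * b i) + a i * a (s i)) := by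
  have key : ∀ i, 13 ≤ (c * (a i + b i) + a i * b i) + a i * a (s i) := by
    intro i
    obtain ⟨⟨h1, h2⟩, ⟨h3, h4⟩, h5, h6, h7, h8⟩ := h i
    obtain ⟨⟨h1', h2'⟩, -, h5', -⟩ := h (s i)
    obtain ⟨hc1, hc2⟩ := hc
    generalize a i = x at *
    generalize a (s i) = y at *
    generalize b i = z at *
    interval_cases c <;> interval_cases x <;> interval_cases y <;> interval_cases z <;> omega
  calc 13 * n = ∑ _i : Fin n, 13 := by simp [mul_comm]
    _ ≤ _ := Finset.sum_le_sum fun i _ => key i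

/-- Suppose an odd cycle is properly colored with `m`, `p`, `q`. If each vertex weighs at least
`V` and each edge at least `E`, with surplus `d` at vertices colored `m` and surpluses `e₁`, `e₂`
at edges colored `{m, p}`, `{m, q}`, then each surplus occurs at least once. -/
theorem le_sum_of_odd_cycle {n : ℕ} (hn : Odd n) (a f g : Fin n → ℕ)
    (ha : ∀ i, a i ≠ a (cyclicSucc i)) (m p q V d E e₁ e₂ : ℕ)
    (hmem : ∀ i, a i = m ∨ a i = p ∨ a i = q)
    (hf : ∀ i, V + (if a i = m then d else 0) ≤ f i)
    (hg : ∀ i, E ≤ g i)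
    (hg₁ : ∀ i, a i ≠ q → a (cyclicSucc i) ≠ q → E + e₁ ≤ g i)
    (hg₂ : ∀ i, a i ≠ p → a (cyclicSucc i) ≠ p → E + e₂ ≤ g i) :
    (V + E) * n + d + e₁ + e₂ ≤ ∑ i, (f i + g i) := by
  obtain ⟨k, hk, hk'⟩ := exists_edge_avoiding hn a ha q
  obtain ⟨l, hl, hl'⟩ := exists_edge_avoiding hn a ha p
  have hkl : k ≠ l := by
    rintro rfl
    have := ha k
    have := hmem k
    have := hmem (cyclicSucc k)
    omega
  obtain ⟨j, hj⟩ : ∃ j, a j = m := by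
    by_contra! h
    have := ha k
    have := hmem k
    have := hmem (cyclicSucc k)
    have := h k
    have := h (cyclicSucc k)
    omega
  calc (V + E) * n + d + e₁ + e₂
      = ∑ i, ((V + (if i = j then d else 0)) +
          (E + (if i = k then e₁ else 0) + (if i = l then e₂ else 0))) := by
        simp only [Finset.sum_add_distrib, Finset.sum_ite_eq', Finset.mem_univ, if_true,
          Finset.sum_const, Finset.card_univ, Fintype.card_fin, smul_eq_mul]
        ring
    _ ≤ _ := by
        refine Finset.sum_le_sum fun i _ => add_le_add ?_ ?_
        · refine le_trans ?_ (hf i)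
          by_cases hij : i = j
          · simp [hij, hj]
          · simp [hij]
        · by_cases hik : i = k
          · subst hik
            simpa [hkl] using hg₁ i hk hk'
          · by_cases hil : i = l
            · subst hil
              simpa [hik] using hg₂ i hl hl'
            · simpa [hik, hil] using hg i

theorem le_sum_of_odd_of_surplus {n : ℕ} (ho : Odd n) {c : ℕ} {a b : Fin n → ℕ}
    (h : ∀ i, (1 ≤ a i ∧ a i ≤ 4) ∧ (1 ≤ b i ∧ b i ≤ 4) ∧ c ≠ a i ∧ c ≠ b i ∧ a i ≠ b i ∧
      a i ≠ a (cyclicSucc i)) (m p q V d E e₁ e₂ : ℕ)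
    (hV : ∀ x ∈ Finset.Icc 1 4, ∀ z ∈ Finset.Icc 1 4, c ≠ x → c ≠ z → x ≠ z →
      (x = m ∨ x = p ∨ x = q) ∧ V + (if x = m then d else 0) ≤ c * (x + z) + x * z)
    (hE : ∀ x ∈ Finset.Icc 1 4, ∀ y ∈ Finset.Icc 1 4, c ≠ x → c ≠ y → x ≠ y →
      E ≤ x * y ∧ (x ≠ q → y ≠ q → E + e₁ ≤ x * y) ∧ (x ≠ p → y ≠ p → E + e₂ ≤ x * y)) :
    (V + E) * n + d + e₁ + e₂ ≤
      ∑ i, ((c * (a i + b i) + a i * b i) + a i * a (cyclicSucc i)) := by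
  have hv i := hV (a i) (Finset.mem_Icc.mpr (h i).1) (b i) (Finset.mem_Icc.mpr (h i).2.1)
    (h i).2.2.1 (h i).2.2.2.1 (h i).2.2.2.2.1
  have he i := hE (a i) (Finset.mem_Icc.mpr (h i).1) (a (cyclicSucc i))
    (Finset.mem_Icc.mpr (h (cyclicSucc i)).1) (h i).2.2.1 (h (cyclicSucc i)).2.2.1
    (h i).2.2.2.2.2
  exact le_sum_of_odd_cycle ho a (fun i => c * (a i + b i) + a i * b i)
    (fun i => a i * a (cyclicSucc i)) (fun i => (h i).2.2.2.2.2) m p q V d E e₁ e₂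
    (fun i => (hv i).1) (fun i => (hv i).2) (fun i => (he i).1) (fun i => (he i).2.1)
    (fun i => (he i).2.2)

theorem le_sum_of_odd {n : ℕ} (hn : 3 ≤ n) (ho : Odd n) {c : ℕ} {a b : Fin n → ℕ}
    (hc : 1 ≤ c ∧ c ≤ 4)
    (h : ∀ i, (1 ≤ a i ∧ a i ≤ 4) ∧ (1 ≤ b i ∧ b i ≤ 4) ∧ c ≠ a i ∧ c ≠ b i ∧ a i ≠ b i ∧
      a i ≠ a (cyclicSucc i)) :
    13 * n + 16 ≤ ∑ i, ((c * (a i + b i) + a i * b i) + a i * a (cyclicSucc i)) := by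
  obtain ⟨hc1, hc2⟩ := hc
  interval_cases c
  · refine le_trans ?_ (le_sum_of_odd_of_surplus ho h 4 2 3 11 3 6 2 6 (by decide) (by decide))
    omega
  · refine le_trans ?_ (le_sum_of_odd_of_surplus ho h 4 1 3 11 3 3 1 9 (by decide) (by decide))
    omega
  · refine le_trans ?_ (le_sum_of_odd_of_surplus ho h 4 1 2 11 8 2 2 6 (by decide) (by decide))
    omega
  · refine le_trans ?_ (le_sum_of_odd_of_surplus ho h 3 1 2 14 5 2 1 4 (by decide) (by decide))
    omega

theorem flower_M2_min (n : ℕ) (hn : 3 ≤ n) :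
    (Even n → IsLeast {x : ℚ | ∃ ζ : GV n → ℕ,
        IsProperColoring (flowerGraph n) (chi (flowerGraph n)) ζ ∧ x = M2 (flowerGraph n) ζ}
      (13 * (n : ℚ))) ∧
    (Odd n → IsLeast {x : ℚ | ∃ ζ : GV n → ℕ,
        IsProperColoring (flowerGraph n) (chi (flowerGraph n)) ζ ∧ x = M2 (flowerGraph n) ζ}
      (13 * (n : ℚ) + 16)) := by
  refine ⟨fun he => ?_, fun ho => ?_⟩
  · have hp := isProperColoring_even hn he
    rw [chi_eq_succ _ 2 _ hp (not_isProperColoring_two hn)]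
    refine ⟨⟨_, hp, (M2_evenFlowerColoring hn he).symm⟩, ?_⟩
    rintro x ⟨ζ, hζ, rfl⟩
    obtain ⟨h1, h2⟩ := (isProperColoring_flowerGraph_iff hn _ ζ).mp hζ
    rw [M2_flowerGraph hn]
    exact_mod_cast le_sum_of_even cyclicSucc h1 h2
  · have hp := isProperColoring_odd hn ho
    rw [chi_eq_succ _ 3 _ hp (not_isProperColoring_three hn ho)]
    refine ⟨⟨_, hp, (M2_oddFlowerColoring hn ho).symm⟩, ?_⟩
    rintro x ⟨ζ, hζ, rfl⟩
    obtain ⟨h1, h2⟩ := (isProperColoring_flowerGraph_iff hn _ ζ).mp hζ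
    rw [M2_flowerGraph hn]
    exact_mod_cast le_sum_of_odd hn ho h1 h2
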